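/- arXiv:2202.09575 — 2 statements merged into one kernel-verified Lean document; each statement's English description precedes it below -/
import Mathlib

section
/- Let W be an xy-symmetric weight function on a measurable set Ω ⊆ ℝ² and let {Sₙ} be the MOPS of W on Ω. Suppose that for each n ≥ 0 and 0 ≤ k ≤ n there is a real bivariate polynomial q_{n,k} such that S_{2n+2,2k+1}(x,y) = x·y·q_{n,k}(x²,y²) for all (x,y). Then each q_{n,k} is monic with q_{n,k}(u,v) = u^{n−k} v^k + (terms of total degree < n), and the vectors Q̂ₙ = (q_{n,0},…,q_{n,n})ᵀ form the MOPS of the weight W^{(1,1)} on Ω*: ∫_{Ω*} Q̂ₙ(u,v) Q̂ₘ(u,v)ᵀ W^{(1,1)}(u,v) du dv = 0 whenever n ≠ m. -/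
noncomputable section

open MeasureTheory MvPolynomial

/-- Evaluation of a bivariate polynomial at a point of `ℝ × ℝ`. -/
def ev (p : ℝ × ℝ) (f : MvPolynomial (Fin 2) ℝ) : ℝ := eval ![p.1, p.2] f

/-- `W` is a weight function on the measurable set `Ω ⊆ ℝ²`: nonnegative and measurable,
positive on a set of positive Lebesgue measure, with all moments finite. -/
def IsWeight (Ω : Set (ℝ × ℝ)) (W : ℝ × ℝ → ℝ) : Prop :=
  MeasurableSet Ω ∧ Measurable W ∧ (∀ p ∈ Ω, 0 ≤ W p) ∧
    0 < volume {p | p ∈ Ω ∧ 0 < W p} ∧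
    ∀ h k : ℕ, IntegrableOn (fun p : ℝ × ℝ => p.1 ^ h * p.2 ^ k * W p) Ω

/-- `W` is an `xy`-symmetric weight on `Ω`: `Ω` is invariant under `(x,y) ↦ (-x,y)` and
`(x,y) ↦ (x,-y)`, and `W(-x,y) = W(x,y) = W(x,-y)` on `Ω`. -/
def XYSymmetric (Ω : Set (ℝ × ℝ)) (W : ℝ × ℝ → ℝ) : Prop :=
  (∀ p : ℝ × ℝ, p ∈ Ω → (-p.1, p.2) ∈ Ω ∧ (p.1, -p.2) ∈ Ω) ∧
    ∀ p ∈ Ω, W (-p.1, p.2) = W p ∧ W (p.1, -p.2) = W p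

/-- `f` is monic of the form `x^(n-j) y^j + (terms of total degree < n)`. -/
def MonicLead (n j : ℕ) (f : MvPolynomial (Fin 2) ℝ) : Prop :=
  f = X 0 ^ (n - j) * X 1 ^ j ∨ (f - X 0 ^ (n - j) * X 1 ^ j).totalDegree < n

/-- `P` is the monic orthogonal polynomial system (MOPS) of the weight `W` on `Ω`:
each `P n j` is monic with leading term `x^(n-j) y^j`, and vectors of different degrees
are mutually orthogonal. -/
def IsMOPS (Ω : Set (ℝ × ℝ)) (W : ℝ × ℝ → ℝ)
    (P : (n : ℕ) → Fin (n + 1) → MvPolynomial (Fin 2) ℝ) : Prop :=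
  (∀ (n : ℕ) (j : Fin (n + 1)), MonicLead n (j : ℕ) (P n j)) ∧
    ∀ m n : ℕ, m ≠ n → ∀ (i : Fin (m + 1)) (j : Fin (n + 1)),
      ∫ p in Ω, ev p (P m i) * ev p (P n j) * W p = 0

/-- The image domain `Ω* = {(u,v) : u ≥ 0, v ≥ 0, (√u, √v) ∈ Ω}`. -/
def Ωstar (Ω : Set (ℝ × ℝ)) : Set (ℝ × ℝ) :=
  {q | 0 ≤ q.1 ∧ 0 ≤ q.2 ∧ (Real.sqrt q.1, Real.sqrt q.2) ∈ Ω}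

/-- The weight `W^(0,0)(u,v) = (1/4) (uv)^(-1/2) W(√u, √v)` on `Ω*`. -/
def W00 (W : ℝ × ℝ → ℝ) : ℝ × ℝ → ℝ :=
  fun q => (1 / 4) * W (Real.sqrt q.1, Real.sqrt q.2) / Real.sqrt (q.1 * q.2)

/-- If `f(x,y) = x y g(x²,y²)` and `f` is monic with leading term
`x^(2(n-k)+1) y^(2k+1)`, then `g` is monic with leading term `u^(n-k) v^k`. -/
lemma MonicLead.of_eval_sq {n k : ℕ} (hk : k ≤ n) {f g : MvPolynomial (Fin 2) ℝ}
    (hf : MonicLead (2 * n + 2) (2 * k + 1) f)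
    (hfg : ∀ x y : ℝ, eval ![x, y] f = x * y * eval ![x ^ 2, y ^ 2] g) :
    MonicLead n k g := by
  have hf_eq : f = X 0 * X 1 * expand 2 g := by
    refine MvPolynomial.funext fun v ↦ ?_
    have hv : v = ![v 0, v 1] := by ext i; fin_cases i <;> rfl
    have hsq : v ^ 2 = ![v 0 ^ 2, v 1 ^ 2] := by ext i; fin_cases i <;> rfl
    rw [map_mul, map_mul, eval_X, eval_X, eval_expand, hsq, ← hfg, ← hv]
  have hsub : f - X 0 ^ (2 * n + 2 - (2 * k + 1)) * X 1 ^ (2 * k + 1) =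
      X 0 * X 1 * expand 2 (g - X 0 ^ (n - k) * X 1 ^ k) := by
    rw [hf_eq, map_sub, map_mul, map_pow, map_pow, expand_X, expand_X,
      show 2 * n + 2 - (2 * k + 1) = 2 * (n - k) + 1 by omega]
    ring
  by_cases hg : g = X 0 ^ (n - k) * X 1 ^ k
  · exact .inl hg
  right
  have he : expand 2 (g - X 0 ^ (n - k) * X 1 ^ k) ≠ 0 :=
    (expand_ne_zero two_pos).2 (sub_ne_zero.2 hg)
  have hX : (X 0 * X 1 : MvPolynomial (Fin 2) ℝ) ≠ 0 := mul_ne_zero (X_ne_zero 0) (X_ne_zero 1)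
  rcases hf with hf | hf
  · exact absurd (hsub.symm.trans (sub_eq_zero.2 hf)) (mul_ne_zero hX he)
  · rw [hsub, totalDegree_mul_of_isDomain hX he,
      totalDegree_mul_of_isDomain (X_ne_zero 0) (X_ne_zero 1), totalDegree_X, totalDegree_X,
      totalDegree_expand] at hf
    omega

lemma IsWeight.integrableOn_ev_mul {Ω : Set (ℝ × ℝ)} {W : ℝ × ℝ → ℝ} (hW : IsWeight Ω W)
    (f : MvPolynomial (Fin 2) ℝ) : IntegrableOn (fun p ↦ ev p f * W p) Ω := by
  simp only [ev, eval_eq', Fin.prod_univ_two, Finset.sum_mul]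
  refine integrable_finsetSum _ fun d _ ↦ ?_
  simpa [mul_assoc] using (hW.2.2.2.2 (d 0) (d 1)).const_mul (coeff d f)

lemma integral_eq_two_mul_setIntegral {α : Type*} [MeasurableSpace α] {μ : Measure α}
    {G : α → ℝ} {R : α → α} {A : Set α} (hG : Integrable G μ) (hR : MeasurePreserving R μ μ)
    (hRe : MeasurableEmbedding R) (hinv : ∀ p, G (R p) = G p) (hA : MeasurableSet A)
    (hRA : R ⁻¹' A =ᵐ[μ] (Aᶜ : Set α)) : ∫ p, G p ∂μ = 2 * ∫ p in A, G p ∂μ := by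
  have h := hR.setIntegral_preimage_emb hRe G A
  simp only [hinv] at h
  rw [← integral_add_compl hA hG, ← setIntegral_congr_set hRA, h, two_mul]

lemma integral_eq_four_mul_setIntegral_quadrant {G : ℝ × ℝ → ℝ} (hG : Integrable G)
    (h1 : ∀ p : ℝ × ℝ, G (-p.1, p.2) = G p) (h2 : ∀ p : ℝ × ℝ, G (p.1, -p.2) = G p) :
    ∫ p, G p = 4 * ∫ p in Set.Ioi 0 ×ˢ Set.Ioi 0, G p := by
  have hz1 : ∀ᵐ p : ℝ × ℝ, p.1 ≠ 0 :=
    Measure.quasiMeasurePreserving_fst.ae (Measure.ae_ne volume (0 : ℝ))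
  have hz2 : ∀ᵐ p : ℝ × ℝ, p.2 ≠ 0 :=
    Measure.quasiMeasurePreserving_snd.ae (Measure.ae_ne volume (0 : ℝ))
  have hm1 : MeasurableSet {p : ℝ × ℝ | 0 < p.1} := measurableSet_lt measurable_const measurable_fst
  have hm2 : MeasurableSet {p : ℝ × ℝ | 0 < p.2} := measurableSet_lt measurable_const measurable_snd
  have hneg : MeasurePreserving (Neg.neg : ℝ → ℝ) := Measure.measurePreserving_neg volume
  have hnege : MeasurableEmbedding (Neg.neg : ℝ → ℝ) := (MeasurableEquiv.neg ℝ).measurableEmbedding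
  have e1 := integral_eq_two_mul_setIntegral (R := Prod.map Neg.neg id) (A := {p | 0 < p.1}) hG
    (hneg.prod (.id volume)) (hnege.prodMap .id) h1 hm1 (by
      filter_upwards [hz1] with p hp
      refine propext ⟨fun (h : 0 < -p.1) ↦ ?_, fun (h : ¬ 0 < p.1) ↦ ?_⟩
      · exact fun (h' : 0 < p.1) ↦ by linarith
      · exact neg_pos.2 (lt_of_le_of_ne (not_lt.1 h) hp))
  have e2 := integral_eq_two_mul_setIntegral (R := Prod.map id Neg.neg) (A := {p | 0 < p.2})
    (hG.indicator hm1) ((MeasurePreserving.id volume).prod hneg) (MeasurableEmbedding.id.prodMap hnege)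
    (fun p ↦ by
      by_cases hp : 0 < p.1
      · simpa [Set.indicator, hp, Prod.map] using h2 p
      · simp [Set.indicator, hp]) hm2 (by
      filter_upwards [hz2] with p hp
      refine propext ⟨fun (h : 0 < -p.2) ↦ ?_, fun (h : ¬ 0 < p.2) ↦ ?_⟩
      · exact fun (h' : 0 < p.2) ↦ by linarith
      · exact neg_pos.2 (lt_of_le_of_ne (not_lt.1 h) hp))
  rw [integral_indicator hm1, setIntegral_indicator hm1] at e2
  rw [e1, e2, ← mul_assoc, show {p : ℝ × ℝ | 0 < p.2} ∩ {p | 0 < p.1} = Set.Ioi 0 ×ˢ Set.Ioi 0 by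
    ext p; simp [and_comm]]
  norm_num

lemma setIntegral_eq_four_mul_setIntegral_quadrant {Ω : Set (ℝ × ℝ)} {F : ℝ × ℝ → ℝ}
    (hΩ : MeasurableSet Ω) (hF : IntegrableOn F Ω)
    (hsymΩ : ∀ p : ℝ × ℝ, p ∈ Ω → (-p.1, p.2) ∈ Ω ∧ (p.1, -p.2) ∈ Ω)
    (hsymF : ∀ p ∈ Ω, F (-p.1, p.2) = F p ∧ F (p.1, -p.2) = F p) :
    ∫ p in Ω, F p = 4 * ∫ p in Ω ∩ Set.Ioi 0 ×ˢ Set.Ioi 0, F p := by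
  have hs1 (p : ℝ × ℝ) : (-p.1, p.2) ∈ Ω ↔ p ∈ Ω :=
    ⟨fun h ↦ by simpa using (hsymΩ _ h).1, fun h ↦ (hsymΩ p h).1⟩
  have hs2 (p : ℝ × ℝ) : (p.1, -p.2) ∈ Ω ↔ p ∈ Ω :=
    ⟨fun h ↦ by simpa using (hsymΩ _ h).2, fun h ↦ (hsymΩ p h).2⟩
  rw [← integral_indicator hΩ, integral_eq_four_mul_setIntegral_quadrant (hF.integrable_indicator hΩ),
    setIntegral_indicator hΩ, Set.inter_comm]
  · intro p
    by_cases hp : p ∈ Ω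
    · simp [Set.indicator, hs1, hp, (hsymF p hp).1]
    · simp [Set.indicator, hs1, hp]
  · intro p
    by_cases hp : p ∈ Ω
    · simp [Set.indicator, hs2, hp, (hsymF p hp).2]
    · simp [Set.indicator, hs2, hp]

/-- The change of variables `(u,v) = (x²,y²)` on the open positive quadrant. -/
lemma setIntegral_image_sq {s : Set (ℝ × ℝ)} (hs : MeasurableSet s)
    (hpos : s ⊆ Set.Ioi 0 ×ˢ Set.Ioi 0) (g : ℝ × ℝ → ℝ) :
    ∫ z in (fun p : ℝ × ℝ ↦ (p.1 ^ 2, p.2 ^ 2)) '' s, g z =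
      ∫ p in s, 4 * (p.1 * p.2) * g (p.1 ^ 2, p.2 ^ 2) := by
  let D (p : ℝ × ℝ) : ℝ × ℝ →L[ℝ] ℝ × ℝ :=
    ((2 * p.1) • ContinuousLinearMap.id ℝ ℝ).prodMap ((2 * p.2) • ContinuousLinearMap.id ℝ ℝ)
  have hD (p : ℝ × ℝ) : HasFDerivAt (fun p : ℝ × ℝ ↦ (p.1 ^ 2, p.2 ^ 2)) (D p) p := by
    have h1 := (hasFDerivAt_fst (𝕜 := ℝ) (p := p)).pow 2
    have h2 := (hasFDerivAt_snd (𝕜 := ℝ) (p := p)).pow 2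
    have hDp : D p = ((2 • p.1 ^ (2 - 1)) • ContinuousLinearMap.fst ℝ ℝ ℝ).prod
        ((2 • p.2 ^ (2 - 1)) • ContinuousLinearMap.snd ℝ ℝ ℝ) := by
      ext <;> simp [D]
    rw [hDp]
    exact h1.prodMk h2
  have hdet (p : ℝ × ℝ) : (D p).det = 4 * (p.1 * p.2) := by
    have : ((D p : ℝ × ℝ →L[ℝ] ℝ × ℝ) : ℝ × ℝ →ₗ[ℝ] ℝ × ℝ) =
        ((2 * p.1) • LinearMap.id).prodMap ((2 * p.2) • LinearMap.id) := rfl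
    rw [ContinuousLinearMap.det, this, LinearMap.det_prodMap]
    simp
    ring
  have hinj : Set.InjOn (fun p : ℝ × ℝ ↦ (p.1 ^ 2, p.2 ^ 2)) s := by
    intro p hp r hr h
    have hp' := hpos hp
    have hr' := hpos hr
    simp only [Prod.mk.injEq] at h
    exact Prod.ext ((pow_left_inj₀ hp'.1.le hr'.1.le two_ne_zero).1 h.1)
      ((pow_left_inj₀ hp'.2.le hr'.2.le two_ne_zero).1 h.2)
  rw [integral_image_eq_integral_abs_det_fderiv_smul volume hs
    (fun p _ ↦ (hD p).hasFDerivWithinAt) hinj]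
  refine setIntegral_congr_fun hs fun p hp ↦ ?_
  have hp' := hpos hp
  simp only [hdet, smul_eq_mul]
  rw [abs_of_pos (mul_pos four_pos (mul_pos hp'.1 hp'.2))]

lemma measurableSet_Ωstar {Ω : Set (ℝ × ℝ)} (hΩ : MeasurableSet Ω) :
    MeasurableSet (Ωstar Ω) :=
  (measurableSet_le measurable_const measurable_fst).inter
    ((measurableSet_le measurable_const measurable_snd).inter
      ((measurable_fst.sqrt.prodMk measurable_snd.sqrt) hΩ))

lemma image_sq_inter_quadrant (Ω : Set (ℝ × ℝ)) :
    (fun p : ℝ × ℝ ↦ (p.1 ^ 2, p.2 ^ 2)) '' (Ω ∩ Set.Ioi 0 ×ˢ Set.Ioi 0) =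
      Ωstar Ω ∩ Set.Ioi 0 ×ˢ Set.Ioi 0 := by
  ext z
  constructor
  · rintro ⟨p, ⟨hp, hp1, hp2⟩, rfl⟩
    have h1 : 0 < p.1 := hp1
    have h2 : 0 < p.2 := hp2
    refine ⟨⟨sq_nonneg _, sq_nonneg _, ?_⟩, pow_pos h1 2, pow_pos h2 2⟩
    simpa [Real.sqrt_sq h1.le, Real.sqrt_sq h2.le] using hp
  · rintro ⟨⟨h1, h2, h⟩, hz1, hz2⟩
    exact ⟨(√z.1, √z.2), ⟨h, Real.sqrt_pos.2 hz1, Real.sqrt_pos.2 hz2⟩,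
      Prod.ext (Real.sq_sqrt h1) (Real.sq_sqrt h2)⟩

lemma setIntegral_Ωstar_eq {Ω : Set (ℝ × ℝ)} (hΩ : MeasurableSet Ω) (W f : ℝ × ℝ → ℝ) :
    ∫ z in Ωstar Ω, f z * (z.1 * z.2 * W00 W z) =
      ∫ p in Ω ∩ Set.Ioi 0 ×ˢ Set.Ioi 0,
        (p.1 * p.2) ^ 2 * f (p.1 ^ 2, p.2 ^ 2) * W p := by
  have hq : MeasurableSet (Ω ∩ Set.Ioi 0 ×ˢ Set.Ioi 0) :=
    hΩ.inter (measurableSet_Ioi.prod measurableSet_Ioi)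
  rw [setIntegral_eq_of_subset_of_forall_sdiff_eq_zero (measurableSet_Ωstar hΩ)
    (Set.inter_subset_left (t := Set.Ioi 0 ×ˢ Set.Ioi 0)), ← image_sq_inter_quadrant,
    setIntegral_image_sq hq Set.inter_subset_right]
  · refine setIntegral_congr_fun hq fun p hp ↦ ?_
    have h1 : 0 < p.1 := hp.2.1
    have h2 : 0 < p.2 := hp.2.2
    simp only [W00, ← mul_pow, Real.sqrt_sq h1.le, Real.sqrt_sq h2.le,
      Real.sqrt_sq (mul_pos h1 h2).le]
    field_simp
  · rintro z ⟨hmem, hz⟩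
    have h1 : 0 ≤ z.1 := hmem.1
    have h2 : 0 ≤ z.2 := hmem.2.1
    have : z.1 * z.2 = 0 := by
      by_contra h
      exact hz ⟨hmem, h1.lt_of_ne' (left_ne_zero_of_mul h), h2.lt_of_ne' (right_ne_zero_of_mul h)⟩
    simp [this]

/-- If `{Sₙ}` is the MOPS of an `xy`-symmetric weight `W` on `Ω` and
`S_{2n+2,2k+1}(x,y) = x y q_{n,k}(x²,y²)`, then the `q_{n,k}` are monic with leading
term `u^(n-k) v^k` and the vectors `(q_{n,0},…,q_{n,n})ᵀ` form the MOPS of the weight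
`W^(1,1)(u,v) = u v W^(0,0)(u,v)` on `Ω*`. -/
theorem stmt8 (Ω : Set (ℝ × ℝ)) (W : ℝ × ℝ → ℝ) (hW : IsWeight Ω W)
    (hsym : XYSymmetric Ω W)
    (S : (n : ℕ) → Fin (n + 1) → MvPolynomial (Fin 2) ℝ) (hS : IsMOPS Ω W S)
    (q : (n : ℕ) → Fin (n + 1) → MvPolynomial (Fin 2) ℝ)
    (hrel : ∀ (n : ℕ) (k : Fin (n + 1)) (x y : ℝ),
      eval ![x, y] (S (2 * n + 2) ⟨2 * (k : ℕ) + 1, by have := k.isLt; omega⟩) =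
        x * y * eval ![x ^ 2, y ^ 2] (q n k)) :
    IsMOPS (Ωstar Ω) (fun z => z.1 * z.2 * W00 W z) q := by
  refine ⟨fun n k ↦ ?_, fun m n hmn i j ↦ ?_⟩
  · have hlead := hS.1 (2 * n + 2) ⟨2 * (k : ℕ) + 1, by omega⟩
    exact hlead.of_eval_sq (Nat.lt_succ_iff.1 k.isLt) (hrel n k)
  have horth := hS.2 (2 * m + 2) (2 * n + 2) (by omega) ⟨2 * (i : ℕ) + 1, by omega⟩
    ⟨2 * (j : ℕ) + 1, by omega⟩
  have hint := hW.integrableOn_ev_mul (S (2 * m + 2) ⟨2 * (i : ℕ) + 1, by omega⟩ *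
    S (2 * n + 2) ⟨2 * (j : ℕ) + 1, by omega⟩)
  simp only [ev, map_mul, hrel] at horth hint
  have hfold := setIntegral_eq_four_mul_setIntegral_quadrant hW.1 hint hsym.1
    fun p hp ↦ by simp [(hsym.2 p hp).1, (hsym.2 p hp).2]
  rw [hfold] at horth
  rw [setIntegral_Ωstar_eq hW.1 W fun z ↦ ev z (q m i) * ev z (q n j)]
  refine Eq.trans ?_ ((mul_eq_zero.1 horth).resolve_left four_ne_zero)
  congr 1 with p
  simp only [ev]
  ring
end
end

section
/- Under the quadratic-decomposition setup, assume in addition the zero patterns (0-indexed entries): the odd-position entries of each P^{(0,0)}ₙ and each P^{(1,0)}ₙ vanish, and the even-position entries of each P^{(1,1)}ₙ and each P^{(0,1)}ₙ vanish; define P̂ₙ^{(i,j)} = J_n^{(i,j)} P^{(i,j)}ₙ. Then for all n ≥ 0 and k ∈ {1,2} (u₁ = u, u₂ = v, vectors and matrices of negative index being 0): (i) P̂^{(0,0)}ₙ = P̂^{(2−k,k−1)}ₙ + Γ̂^{(0,0)}_{n,k} P̂^{(2−k,k−1)}_{n−1} with Γ̂^{(0,0)}_{n,k} = J_n^{(0,0)}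 Γ_{2n,k} (J_{n−1}^{(2−k,k−1)})ᵀ; (ii) u_k·P̂^{(1,1)}_{n−1} = L_{n−1,k} P̂^{(k−1,2−k)}ₙ + Γ̂^{(0,1)}_{n,k} P̂^{(k−1,2−k)}_{n−1} with Γ̂^{(0,1)}_{n,k} = J_{n−1}^{(1,1)} Γ_{2n,k} (J_{n−1}^{(k−1,2−k)})ᵀ; (iii) P̂^{(k−1,2−k)}ₙ = P̂^{(1,1)}ₙ + Γ̂^{(1,1)}_{n,k} P̂^{(1,1)}_{n−1} with Γ̂^{(1,1)}_{n,k} = J_n^{(k−1,2−k)} Γ_{2n+1,k} (J_{n−1}^{(1,1)})ᵀ; (iv) u_k·P̂^{(2−k,k−1)}ₙ = L_{n,k} P̂^{(0,0)}_{n+1} + Γ̂^{(1,0)}_{n,k} P̂^{(0,0)}ₙ with Γ̂^{(1,0)}_{n,k} = J_n^{(2−k,k−1)} Γ_{2n+1,k} (J_n^{(0,0)})ᵀ. -/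
noncomputable section

open MvPolynomial Finset

/-- Entry `(h, m)` of the matrix `L_{n,k}` (`k = 1, 2`): `1` iff `m = h + (k-1)`. -/
def Lent (k h m : ℕ) : ℝ := if m = h + (k - 1) then 1 else 0

/-- Entry `(h, m)` of the matrix `J_n^(i,j)`: `1` iff `m = 2 h + j`. -/
def Jent (j h m : ℕ) : ℝ := if m = 2 * h + j then 1 else 0

/-- Two real bivariate polynomials with equal values at all pairs of squares of positive reals
have equal values everywhere. -/
theorem eval_eq_of_eval_sq_eq {p q : MvPolynomial (Fin 2) ℝ}
    (h : ∀ x y : ℝ, 0 < x → 0 < y → eval ![x ^ 2, y ^ 2] p = eval ![x ^ 2, y ^ 2] q)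
    (u v : ℝ) : eval ![u, v] p = eval ![u, v] q := by
  have hpq : p = q := by
    refine MvPolynomial.funext_set (fun _ => Set.Ioi (0 : ℝ)) (fun _ => Set.Ioi_infinite 0) ?_
    intro w hw
    have h0 : 0 < w 0 := hw 0 (Set.mem_univ _)
    have h1 : 0 < w 1 := hw 1 (Set.mem_univ _)
    have hw' : w = ![√(w 0) ^ 2, √(w 1) ^ 2] := by
      ext j
      fin_cases j
      · simp [Real.sq_sqrt h0.le]
      · simp [Real.sq_sqrt h1.le]
    rw [hw']
    exact h _ _ (Real.sqrt_pos.2 h0) (Real.sqrt_pos.2 h1)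
  rw [hpq]

/-- If `x A(x², y²) + y B(x², y²)` vanishes identically, then so does `A`. -/
theorem eval_left_eq_zero {A B : MvPolynomial (Fin 2) ℝ}
    (h : ∀ x y : ℝ, x * eval ![x ^ 2, y ^ 2] A + y * eval ![x ^ 2, y ^ 2] B = 0)
    (u v : ℝ) : eval ![u, v] A = 0 := by
  rw [← map_zero (eval ![u, v])]
  refine eval_eq_of_eval_sq_eq (fun x y hx _ => ?_) u v
  have h₁ := h x y
  have h₂ := h x (-y)
  rw [neg_sq] at h₂
  rw [map_zero]
  refine (mul_eq_zero.1 ?_).resolve_left hx.ne'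
  linarith

/-- If `x A(x², y²) + y B(x², y²)` vanishes identically, then so does `B`. -/
theorem eval_right_eq_zero {A B : MvPolynomial (Fin 2) ℝ}
    (h : ∀ x y : ℝ, x * eval ![x ^ 2, y ^ 2] A + y * eval ![x ^ 2, y ^ 2] B = 0)
    (u v : ℝ) : eval ![u, v] B = 0 := by
  rw [← map_zero (eval ![u, v])]
  refine eval_eq_of_eval_sq_eq (fun x y _ hy => ?_) u v
  have h₁ := h x y
  have h₂ := h (-x) y
  rw [neg_sq] at h₂
  rw [map_zero]
  refine (mul_eq_zero.1 ?_).resolve_left hy.ne'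
  linarith

/-- If `A(x², y²) + x y B(x², y²)` vanishes identically, then so does `A`. -/
theorem eval_diag_eq_zero {A B : MvPolynomial (Fin 2) ℝ}
    (h : ∀ x y : ℝ, eval ![x ^ 2, y ^ 2] A + x * y * eval ![x ^ 2, y ^ 2] B = 0)
    (u v : ℝ) : eval ![u, v] A = 0 := by
  rw [← map_zero (eval ![u, v])]
  refine eval_eq_of_eval_sq_eq (fun x y _ _ => ?_) u v
  have h₁ := h x y
  have h₂ := h x (-y)
  rw [neg_sq] at h₂
  rw [map_zero]
  linarith

/-- If `A(x², y²) + x y B(x², y²)` vanishes identically, then so does `B`. -/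
theorem eval_cross_eq_zero {A B : MvPolynomial (Fin 2) ℝ}
    (h : ∀ x y : ℝ, eval ![x ^ 2, y ^ 2] A + x * y * eval ![x ^ 2, y ^ 2] B = 0)
    (u v : ℝ) : eval ![u, v] B = 0 := by
  rw [← map_zero (eval ![u, v])]
  refine eval_eq_of_eval_sq_eq (fun x y hx hy => ?_) u v
  have h₁ := h x y
  have h₂ := h x (-y)
  rw [neg_sq] at h₂
  rw [map_zero]
  refine (mul_eq_zero.1 ?_).resolve_left (mul_pos hx hy).ne'
  linarith

theorem sum_Lent_mul {k i N : ℕ} (h : i + (k - 1) < N) (f : ℕ → ℝ) :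
    ∑ j ∈ range N, Lent k i j * f j = f (i + (k - 1)) := by
  simp [Lent, h]

theorem sum_Jent_mul_Jent {c d i j A B : ℕ} (hi : 2 * i + c < A) (hj : 2 * j + d < B)
    (G : ℕ → ℕ → ℝ) :
    ∑ a ∈ range A, ∑ b ∈ range B, Jent c i a * G a b * Jent d j b
      = G (2 * i + c) (2 * j + d) := by
  simp [Jent, hi, hj]

/-- Compression of the matrix `G` to rows `2 i + c` and columns `2 j + d`, applied to a vector. -/
theorem sum_sum_Jent_mul {c d i A B n : ℕ} (hi : 2 * i + c < A) (hj : ∀ j < n, 2 * j + d < B)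
    (G : ℕ → ℕ → ℝ) (f : ℕ → ℝ) :
    ∑ j ∈ range n, (∑ a ∈ range A, ∑ b ∈ range B, Jent c i a * G a b * Jent d j b) * f j
      = ∑ j ∈ range n, G (2 * i + c) (2 * j + d) * f j :=
  Finset.sum_congr rfl fun j hjn => by
    rw [sum_Jent_mul_Jent hi (hj j (Finset.mem_range.1 hjn)) G]

theorem sum_range_two_mul_eq (f : ℕ → ℝ) (n : ℕ) :
    ∑ b ∈ range (2 * n), f b
      = ∑ j ∈ range n, f (2 * j) + ∑ j ∈ range n, f (2 * j + 1) := by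
  induction n with
  | zero => simp
  | succ n ih =>
    rw [show 2 * (n + 1) = 2 * n + 1 + 1 by ring]
    simp only [Finset.sum_range_succ, ih]
    ring

/-- Short relations between the four 'small' families
`P̂ₙ^(i,j) = J_n^(i,j) P^(i,j)ₙ` of the quadratic decomposition: for all `n ≥ 0` and
`k ∈ {1,2}` (with `u₁ = u`, `u₂ = v`, vectors of negative index being `0`):
(i)   `P̂⁽⁰'⁰⁾ₙ = P̂^(2-k,k-1)ₙ + Γ̂^(0,0)_{n,k} P̂^(2-k,k-1)_{n-1}`,
      `Γ̂^(0,0)_{n,k} = J_n⁽⁰'⁰⁾ Γ_{2n,k} (J_{n-1}^(2-k,k-1))ᵀ`;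
(ii)  `u_k P̂⁽¹'¹⁾_{n-1} = L_{n-1,k} P̂^(k-1,2-k)ₙ + Γ̂^(0,1)_{n,k} P̂^(k-1,2-k)_{n-1}`,
      `Γ̂^(0,1)_{n,k} = J_{n-1}⁽¹'¹⁾ Γ_{2n,k} (J_{n-1}^(k-1,2-k))ᵀ`;
(iii) `P̂^(k-1,2-k)ₙ = P̂⁽¹'¹⁾ₙ + Γ̂^(1,1)_{n,k} P̂⁽¹'¹⁾_{n-1}`,
      `Γ̂^(1,1)_{n,k} = J_n^(k-1,2-k) Γ_{2n+1,k} (J_{n-1}⁽¹'¹⁾)ᵀ`;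
(iv)  `u_k P̂^(2-k,k-1)ₙ = L_{n,k} P̂⁽⁰'⁰⁾_{n+1} + Γ̂^(1,0)_{n,k} P̂⁽⁰'⁰⁾ₙ`,
      `Γ̂^(1,0)_{n,k} = J_n^(2-k,k-1) Γ_{2n+1,k} (J_n⁽⁰'⁰⁾)ᵀ`,
stated entrywise via evaluation (the entries of `P̂⁽⁰'⁰⁾ₙ`, `P̂⁽¹'⁰⁾ₙ` are the
even-position entries of `P⁽⁰'⁰⁾ₙ`, `P⁽¹'⁰⁾ₙ`, and the entries of `P̂⁽¹'¹⁾ₙ`,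
`P̂⁽⁰'¹⁾ₙ` are the odd-position entries of `P⁽¹'¹⁾ₙ`, `P⁽⁰'¹⁾ₙ`). -/
theorem stmt18
    (Γ : ℕ → ℕ → ℕ → ℕ → ℝ)
    (S : ℕ → ℕ → MvPolynomial (Fin 2) ℝ)
    (P00 P11 P10 P01 : ℤ → ℕ → MvPolynomial (Fin 2) ℝ)
    (hneg : ∀ m : ℤ, m < 0 → ∀ i : ℕ,
      P00 m i = 0 ∧ P11 m i = 0 ∧ P10 m i = 0 ∧ P01 m i = 0)
    (hTTR : ∀ (N k : ℕ), k = 1 ∨ k = 2 → ∀ i < N + 1, ∀ x y : ℝ,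
      (if k = 1 then x else y) * eval ![x, y] (S N i) =
        (∑ j ∈ range (N + 2), Lent k i j * eval ![x, y] (S (N + 1) j)) +
        ∑ j ∈ range N, Γ N k i j * eval ![x, y] (S (N - 1) j))
    (hEven : ∀ (N : ℕ), ∀ i < 2 * N + 1, ∀ x y : ℝ,
      eval ![x, y] (S (2 * N) i) =
        eval ![x ^ 2, y ^ 2] (P00 (N : ℤ) i) +
          x * y * eval ![x ^ 2, y ^ 2] (P11 ((N : ℤ) - 1) i))
    (hOdd : ∀ (N : ℕ), ∀ i < 2 * N + 2, ∀ x y : ℝ,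
      eval ![x, y] (S (2 * N + 1) i) =
        x * eval ![x ^ 2, y ^ 2] (P10 (N : ℤ) i) +
          y * eval ![x ^ 2, y ^ 2] (P01 (N : ℤ) i))
    (hzero : ∀ (m : ℤ) (i : ℕ),
      (Odd i → P00 m i = 0 ∧ P10 m i = 0) ∧ (Even i → P11 m i = 0 ∧ P01 m i = 0))
    (n k : ℕ) (hk : k = 1 ∨ k = 2) (u v : ℝ) :
    (∀ i < n + 1,
      eval ![u, v] (P00 (n : ℤ) (2 * i)) =
        eval ![u, v] (if k = 1 then P10 (n : ℤ) (2 * i) else P01 (n : ℤ) (2 * i + 1)) +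
        ∑ j ∈ range n,
          (∑ a ∈ range (2 * n + 1), ∑ b ∈ range (2 * n),
            Jent 0 i a * Γ (2 * n) k a b * Jent (k - 1) j b) *
            eval ![u, v]
              (if k = 1 then P10 ((n : ℤ) - 1) (2 * j) else P01 ((n : ℤ) - 1) (2 * j + 1))) ∧
    (∀ i < n,
      (if k = 1 then u else v) * eval ![u, v] (P11 ((n : ℤ) - 1) (2 * i + 1)) =
        (∑ j ∈ range (n + 1),
          Lent k i j *
            eval ![u, v]
              (if k = 1 then P01 (n : ℤ) (2 * j + 1) else P10 (n : ℤ) (2 * j))) +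
        ∑ j ∈ range n,
          (∑ a ∈ range (2 * n + 1), ∑ b ∈ range (2 * n),
            Jent 1 i a * Γ (2 * n) k a b * Jent (2 - k) j b) *
            eval ![u, v]
              (if k = 1 then P01 ((n : ℤ) - 1) (2 * j + 1) else P10 ((n : ℤ) - 1) (2 * j))) ∧
    (∀ i < n + 1,
      eval ![u, v] (if k = 1 then P01 (n : ℤ) (2 * i + 1) else P10 (n : ℤ) (2 * i)) =
        eval ![u, v] (P11 (n : ℤ) (2 * i + 1)) +
        ∑ j ∈ range n,
          (∑ a ∈ range (2 * n + 2), ∑ b ∈ range (2 * n + 1),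
            Jent (2 - k) i a * Γ (2 * n + 1) k a b * Jent 1 j b) *
            eval ![u, v] (P11 ((n : ℤ) - 1) (2 * j + 1))) ∧
    (∀ i < n + 1,
      (if k = 1 then u else v) *
          eval ![u, v] (if k = 1 then P10 (n : ℤ) (2 * i) else P01 (n : ℤ) (2 * i + 1)) =
        (∑ j ∈ range (n + 2), Lent k i j * eval ![u, v] (P00 ((n : ℤ) + 1) (2 * j))) +
        ∑ j ∈ range (n + 1),
          (∑ a ∈ range (2 * n + 2), ∑ b ∈ range (2 * n + 1),
            Jent (k - 1) i a * Γ (2 * n + 1) k a b * Jent 0 j b) *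
            eval ![u, v] (P00 (n : ℤ) (2 * j))) := by
  have eE : ∀ (N i : ℕ), i < N + 1 → ∀ x y : ℝ,
      eval ![x, y] (S (2 * N) (2 * i)) = eval ![x ^ 2, y ^ 2] (P00 (N : ℤ) (2 * i)) := by
    intro N i hi x y
    rw [hEven N _ (by omega), ((hzero _ _).2 (even_two_mul i)).1]
    simp
  have eO : ∀ (N i : ℕ), i < N → ∀ x y : ℝ,
      eval ![x, y] (S (2 * N) (2 * i + 1)) =
        x * y * eval ![x ^ 2, y ^ 2] (P11 ((N : ℤ) - 1) (2 * i + 1)) := by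
    intro N i hi x y
    rw [hEven N _ (by omega), ((hzero _ _).1 (odd_two_mul_add_one i)).1]
    simp
  have oE : ∀ (N i : ℕ), i < N + 1 → ∀ x y : ℝ,
      eval ![x, y] (S (2 * N + 1) (2 * i)) =
        x * eval ![x ^ 2, y ^ 2] (P10 (N : ℤ) (2 * i)) := by
    intro N i hi x y
    rw [hOdd N _ (by omega), ((hzero _ _).2 (even_two_mul i)).2]
    simp
  have oO : ∀ (N i : ℕ), i < N + 1 → ∀ x y : ℝ,
      eval ![x, y] (S (2 * N + 1) (2 * i + 1)) =
        y * eval ![x ^ 2, y ^ 2] (P01 (N : ℤ) (2 * i + 1)) := by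
    intro N i hi x y
    rw [hOdd N _ (by omega), ((hzero _ _).1 (odd_two_mul_add_one i)).2]
    simp
  have rowEven : ∀ i < 2 * n + 1, ∀ x y : ℝ,
      (if k = 1 then x else y) * eval ![x, y] (S (2 * n) i) =
        eval ![x, y] (S (2 * n + 1) (i + (k - 1))) +
        (x * ∑ j ∈ range n, Γ (2 * n) k i (2 * j) *
            eval ![x ^ 2, y ^ 2] (P10 ((n : ℤ) - 1) (2 * j)) +
          y * ∑ j ∈ range n, Γ (2 * n) k i (2 * j + 1) *
            eval ![x ^ 2, y ^ 2] (P01 ((n : ℤ) - 1) (2 * j + 1))) := by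
    intro i hi x y
    rw [hTTR (2 * n) k hk i hi x y,
      sum_Lent_mul (by omega) (fun j => eval ![x, y] (S (2 * n + 1) j)),
      sum_range_two_mul_eq, Finset.mul_sum, Finset.mul_sum]
    congr 2
    all_goals
      refine Finset.sum_congr rfl fun j hj => ?_
      rw [Finset.mem_range] at hj
      obtain ⟨m, rfl⟩ : ∃ m, n = m + 1 := ⟨n - 1, by omega⟩
      rw [show 2 * (m + 1) - 1 = 2 * m + 1 by omega]
      push_cast
      rw [add_sub_cancel_right]
    · rw [oE m j hj]
      ring
    · rw [oO m j hj]
      ring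
  have rowOdd : ∀ i < 2 * n + 2, ∀ x y : ℝ,
      (if k = 1 then x else y) * eval ![x, y] (S (2 * n + 1) i) =
        eval ![x, y] (S (2 * (n + 1)) (i + (k - 1))) +
        (∑ j ∈ range (n + 1), Γ (2 * n + 1) k i (2 * j) *
            eval ![x ^ 2, y ^ 2] (P00 (n : ℤ) (2 * j)) +
          x * y * ∑ j ∈ range n, Γ (2 * n + 1) k i (2 * j + 1) *
            eval ![x ^ 2, y ^ 2] (P11 ((n : ℤ) - 1) (2 * j + 1))) := by
    intro i hi x y
    rw [hTTR (2 * n + 1) k hk i hi x y,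
      sum_Lent_mul (by omega) (fun j => eval ![x, y] (S (2 * n + 1 + 1) j)),
      Finset.sum_range_succ, sum_range_two_mul_eq, Finset.sum_range_succ _ n,
      show 2 * n + 1 - 1 = 2 * n by omega, eE n n (by omega),
      show 2 * n + 1 + 1 = 2 * (n + 1) by ring]
    have hE : ∑ j ∈ range n, Γ (2 * n + 1) k i (2 * j) * eval ![x, y] (S (2 * n) (2 * j)) =
        ∑ j ∈ range n, Γ (2 * n + 1) k i (2 * j) * eval ![x ^ 2, y ^ 2] (P00 (n : ℤ) (2 * j)) :=
      Finset.sum_congr rfl fun j hj => by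
        rw [eE n j ((Finset.mem_range.1 hj).trans n.lt_succ_self)]
    have hO : ∑ j ∈ range n,
          Γ (2 * n + 1) k i (2 * j + 1) * eval ![x, y] (S (2 * n) (2 * j + 1)) =
        x * y * ∑ j ∈ range n, Γ (2 * n + 1) k i (2 * j + 1) *
          eval ![x ^ 2, y ^ 2] (P11 ((n : ℤ) - 1) (2 * j + 1)) := by
      rw [Finset.mul_sum]
      refine Finset.sum_congr rfl fun j hj => ?_
      rw [eO n j (Finset.mem_range.1 hj)]
      ring
    rw [hE, hO]
    ring
  let T10 (r : ℕ) : MvPolynomial (Fin 2) ℝ :=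
    ∑ j ∈ range n, C (Γ (2 * n) k r (2 * j)) * P10 ((n : ℤ) - 1) (2 * j)
  let T01 (r : ℕ) : MvPolynomial (Fin 2) ℝ :=
    ∑ j ∈ range n, C (Γ (2 * n) k r (2 * j + 1)) * P01 ((n : ℤ) - 1) (2 * j + 1)
  let T00 (r : ℕ) : MvPolynomial (Fin 2) ℝ :=
    ∑ j ∈ range (n + 1), C (Γ (2 * n + 1) k r (2 * j)) * P00 (n : ℤ) (2 * j)
  let T11 (r : ℕ) : MvPolynomial (Fin 2) ℝ :=
    ∑ j ∈ range n, C (Γ (2 * n + 1) k r (2 * j + 1)) * P11 ((n : ℤ) - 1) (2 * j + 1)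
  have eT10 : ∀ (r : ℕ) (w : Fin 2 → ℝ), eval w (T10 r) = ∑ j ∈ range n,
      Γ (2 * n) k r (2 * j) * eval w (P10 ((n : ℤ) - 1) (2 * j)) := by simp [T10]
  have eT01 : ∀ (r : ℕ) (w : Fin 2 → ℝ), eval w (T01 r) = ∑ j ∈ range n,
      Γ (2 * n) k r (2 * j + 1) * eval w (P01 ((n : ℤ) - 1) (2 * j + 1)) := by simp [T01]
  have eT00 : ∀ (r : ℕ) (w : Fin 2 → ℝ), eval w (T00 r) = ∑ j ∈ range (n + 1),
      Γ (2 * n + 1) k r (2 * j) * eval w (P00 (n : ℤ) (2 * j)) := by simp [T00]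
  have eT11 : ∀ (r : ℕ) (w : Fin 2 → ℝ), eval w (T11 r) = ∑ j ∈ range n,
      Γ (2 * n + 1) k r (2 * j + 1) * eval w (P11 ((n : ℤ) - 1) (2 * j + 1)) := by simp [T11]
  simp only [← eT10, ← eT01] at rowEven
  simp only [← eT00, ← eT11] at rowOdd
  clear_value T10 T01 T00 T11
  refine ⟨fun i hi => ?_, fun i hi => ?_, fun i hi => ?_, fun i hi => ?_⟩
  · have row := rowEven (2 * i) (by omega)
    simp only [eE n i hi] at row
    rw [sum_sum_Jent_mul (by omega) (by omega) (Γ (2 * n) k)]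
    rcases hk with rfl | rfl
    · simp only [Nat.sub_self, Nat.add_zero, if_true, oE n i hi] at row ⊢
      have key := eval_left_eq_zero
        (A := P00 n (2 * i) - P10 n (2 * i) - T10 (2 * i))
        (B := -T01 (2 * i))
        (fun x y => by
          simp only [map_sub, map_neg]
          linear_combination row x y) u v
      simp only [map_sub, eT10] at key
      linear_combination key
    · simp only [Nat.add_one_sub_one, OfNat.ofNat_ne_one, if_false, Nat.add_zero, oO n i hi] at row ⊢
      have key := eval_right_eq_zero
        (A := -T10 (2 * i))
        (B := P00 n (2 * i) - P01 n (2 * i + 1) - T01 (2 * i))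
        (fun x y => by
          simp only [map_sub, map_neg]
          linear_combination row x y) u v
      simp only [map_sub, eT01] at key
      linear_combination key
  · have row := rowEven (2 * i + 1) (by omega)
    simp only [eO n i hi] at row
    rw [sum_sum_Jent_mul (by omega) (by omega) (Γ (2 * n) k), sum_Lent_mul (by omega)]
    rcases hk with rfl | rfl
    · simp only [Nat.sub_self, Nat.add_zero, if_true, oO n i (hi.trans n.lt_succ_self)] at row ⊢
      have key := eval_right_eq_zero
        (A := -T10 (2 * i + 1))
        (B := X 0 * P11 (n - 1) (2 * i + 1) - P01 n (2 * i + 1) - T01 (2 * i + 1))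
        (fun x y => by
          simp only [map_sub, map_neg, map_mul, eval_X, Matrix.cons_val_zero]
          linear_combination row x y) u v
      simp only [map_sub, map_mul, eval_X, Matrix.cons_val_zero, eT01] at key
      linear_combination key
    · simp only [Nat.add_one_sub_one, OfNat.ofNat_ne_one, if_false, Nat.sub_self,
        Nat.add_zero, show 2 * i + 1 + 1 = 2 * (i + 1) by ring,
        oE n (i + 1) (Nat.succ_lt_succ hi)] at row ⊢
      have key := eval_left_eq_zero
        (A := X 1 * P11 (n - 1) (2 * i + 1) - P10 n (2 * (i + 1)) - T10 (2 * i + 1))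
        (B := -T01 (2 * i + 1))
        (fun x y => by
          simp only [map_sub, map_neg, map_mul, eval_X, Matrix.cons_val_zero, Matrix.cons_val_one]
          linear_combination row x y) u v
      simp only [map_sub, map_mul, eval_X, Matrix.cons_val_zero, Matrix.cons_val_one, eT10] at key
      linear_combination key
  · rw [sum_sum_Jent_mul (by omega) (by omega) (Γ (2 * n + 1) k)]
    rcases hk with rfl | rfl
    · have row := rowOdd (2 * i + 1) (by omega)
      simp only [Nat.sub_self, Nat.add_zero, if_true, oO n i hi, eO (n + 1) i hi,
        Nat.cast_add, Nat.cast_one, add_sub_cancel_right] at row ⊢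
      have key := eval_cross_eq_zero
        (A := -T00 (2 * i + 1))
        (B := P01 n (2 * i + 1) - P11 n (2 * i + 1) - T11 (2 * i + 1))
        (fun x y => by
          simp only [map_sub, map_neg]
          linear_combination row x y) u v
      simp only [map_sub, eT11] at key
      linear_combination key
    · have row := rowOdd (2 * i) (by omega)
      simp only [Nat.add_one_sub_one, OfNat.ofNat_ne_one, if_false, Nat.sub_self,
        Nat.add_zero, oE n i hi, eO (n + 1) i hi,
        Nat.cast_add, Nat.cast_one, add_sub_cancel_right] at row ⊢
      have key := eval_cross_eq_zero
        (A := -T00 (2 * i))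
        (B := P10 n (2 * i) - P11 n (2 * i + 1) - T11 (2 * i))
        (fun x y => by
          simp only [map_sub, map_neg]
          linear_combination row x y) u v
      simp only [map_sub, eT11] at key
      linear_combination key
  · rw [sum_sum_Jent_mul (by omega) (by omega) (Γ (2 * n + 1) k), sum_Lent_mul (by omega)]
    rcases hk with rfl | rfl
    · have row := rowOdd (2 * i) (by omega)
      simp only [Nat.sub_self, Nat.add_zero, if_true, oE n i hi,
        eE (n + 1) i (hi.trans (n + 1).lt_succ_self), Nat.cast_add, Nat.cast_one] at row ⊢
      have key := eval_diag_eq_zero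
        (A := X 0 * P10 n (2 * i) - P00 (n + 1) (2 * i) - T00 (2 * i))
        (B := -T11 (2 * i))
        (fun x y => by
          simp only [map_sub, map_neg, map_mul, eval_X, Matrix.cons_val_zero]
          linear_combination row x y) u v
      simp only [map_sub, map_mul, eval_X, Matrix.cons_val_zero, eT00] at key
      linear_combination key
    · have row := rowOdd (2 * i + 1) (by omega)
      simp only [Nat.add_one_sub_one, OfNat.ofNat_ne_one, if_false, Nat.add_zero, oO n i hi,
        show 2 * i + 1 + 1 = 2 * (i + 1) by ring, eE (n + 1) (i + 1) (Nat.succ_lt_succ hi),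
        Nat.cast_add, Nat.cast_one] at row ⊢
      have key := eval_diag_eq_zero
        (A := X 1 * P01 n (2 * i + 1) - P00 (n + 1) (2 * (i + 1)) - T00 (2 * i + 1))
        (B := -T11 (2 * i + 1))
        (fun x y => by
          simp only [map_sub, map_neg, map_mul, eval_X, Matrix.cons_val_zero, Matrix.cons_val_one]
          linear_combination row x y) u v
      simp only [map_sub, map_mul, eval_X, Matrix.cons_val_zero, Matrix.cons_val_one, eT00] at key
      linear_combination key
end
end
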